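/- Let X be a semigroup admitting a separable subinvariant metric and with cardinality |X| ≤ cov(M). Suppose that for every injective homomorphism h : X → Y into a topological semigroup Y that is either Polish or Hausdorff 0-discrete, the image h[X] is closed in Y. Then X is polybounded. -/

import Mathlib

open Cardinal Pointwise

universe u

namespace ZeroClosedPaper

/-- The value of the semigroup polynomial with coefficient list `a = [a₀, a₁, …, aₙ]`
(coefficients in `X¹ = WithOne X`) at the point `x`, i.e. `a₀xa₁x⋯xaₙ`,
computed in the monoid `WithOne X`. Its degree (the number of occurrences of `x`)
is `a.length - 1`. -/
def polyVal {X : Type*} [Semigroup X] (a : List (WithOne X)) (x : X) : WithOne X :=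
  match a with
  | [] => 1
  | a₀ :: rest => a₀ * (rest.map (fun ai => (x : WithOne X) * ai)).prod

/-- A subset `A` of a semigroup `X` is algebraic if
`A = {x ∈ X : a₀xa₁⋯xaₙ = b}` for some `n ≥ 1`, `b ∈ X` and `a₀,…,aₙ ∈ X¹`. -/
def IsAlgebraicSet {X : Type*} [Semigroup X] (A : Set X) : Prop :=
  ∃ (a : List (WithOne X)) (b : X), 2 ≤ a.length ∧
    A = {x : X | polyVal a x = (b : WithOne X)}

/-- The polyboundedness number `cov(A_X)`: the smallest cardinality of a cover of `X`
by algebraic subsets of `X`. -/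
noncomputable def covA (X : Type*) [Semigroup X] : Cardinal :=
  sInf {c : Cardinal | ∃ C : Set (Set X), (∀ A ∈ C, IsAlgebraicSet A) ∧
    ⋃₀ C = Set.univ ∧ Cardinal.mk ↥C = c}

/-- A subset `S` of a semigroup `X` is polybounded in `X` if it can be covered by
finitely many algebraic subsets of `X`. -/
def PolyboundedIn {X : Type*} [Semigroup X] (S : Set X) : Prop :=
  ∃ C : Set (Set X), C.Finite ∧ (∀ A ∈ C, IsAlgebraicSet A) ∧ S ⊆ ⋃₀ C

/-- A semigroup is polybounded if it admits a finite cover by algebraic sets. -/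
def Polybounded (X : Type*) [Semigroup X] : Prop :=
  PolyboundedIn (Set.univ : Set X)

/-- A semigroup `X` is polyfinite if there are `n ∈ ℕ` and a finite `F ⊆ X` such that
for all `x, y ∈ X` some semigroup polynomial `f` of degree `≤ n` has `f(x), f(y) ∈ F`. -/
def Polyfinite (X : Type*) [Semigroup X] : Prop :=
  ∃ (n : ℕ) (F : Set X), F.Finite ∧ ∀ x y : X, ∃ a : List (WithOne X),
    2 ≤ a.length ∧ a.length ≤ n + 1 ∧
    (∃ u ∈ F, polyVal a x = (u : WithOne X)) ∧
    (∃ v ∈ F, polyVal a y = (v : WithOne X))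

/-- A semigroup `X` is zero-closed if `X` is closed in its `0`-extension
`X⁰ = WithZero X` endowed with any Hausdorff semigroup topology. -/
def ZeroClosed (X : Type*) [Semigroup X] : Prop :=
  ∀ τ : TopologicalSpace (WithZero X),
    @T2Space (WithZero X) τ → @ContinuousMul (WithZero X) τ _ →
    @IsClosed (WithZero X) τ (Set.range ((↑) : X → WithZero X))

/-- `d` is a pseudometric. -/
def IsPseudometric {X : Type*} (d : X → X → ℝ) : Prop :=
  (∀ x, d x x = 0) ∧ (∀ x y, d x y = d y x) ∧ (∀ x y z, d x z ≤ d x y + d y z)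

/-- `d` is subinvariant: `d(axb, ayb) ≤ d(x,y)` for all `a, b ∈ X¹`
(equivalently, `d` is both left- and right-nonexpansive under translations). -/
def Subinvariant {X : Type*} [Semigroup X] (d : X → X → ℝ) : Prop :=
  (∀ a x y : X, d (a * x) (a * y) ≤ d x y) ∧
  (∀ b x y : X, d (x * b) (y * b) ≤ d x y)

/-- `d` is separable: some countable set is `d`-dense. -/
def SeparablePseudometric {X : Type*} (d : X → X → ℝ) : Prop :=
  ∃ C : Set X, C.Countable ∧ ∀ x : X, ∀ ε : ℝ, 0 < ε → ∃ c ∈ C, d x c < ε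

/-- `cov(M)`: the smallest cardinality of a cover of the real line by meager sets. -/
noncomputable def covMeager : Cardinal :=
  sInf {c : Cardinal | ∃ S : Set (Set ℝ), (∀ A ∈ S, IsMeagre A) ∧
    ⋃₀ S = Set.univ ∧ Cardinal.mk ↥S = c}

/-- `cov(N̄)`: the smallest cardinality of a cover of the real line by closed
Lebesgue-null sets. -/
noncomputable def covClosedNull : Cardinal :=
  sInf {c : Cardinal | ∃ S : Set (Set ℝ),
    (∀ A ∈ S, IsClosed A ∧ MeasureTheory.volume A = 0) ∧
    ⋃₀ S = Set.univ ∧ Cardinal.mk ↥S = c}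

/-- A topological space is power-Lindelöf if each finite power is Lindelöf. -/
def PowerLindelof (Y : Type*) [TopologicalSpace Y] : Prop :=
  ∀ n : ℕ, LindelofSpace (Fin n → Y)

/-- `I` is an ideal of the semigroup `X`. -/
def IsIdeal {X : Type*} [Semigroup X] (I : Set X) : Prop :=
  ∀ x ∈ I, ∀ a : X, x * a ∈ I ∧ a * x ∈ I

section Polynomials

variable {X : Type u} [Semigroup X]

/-- The nonconstant semigroup polynomials of `X`, as functions `X → X`. -/
inductive IsPoly : (X → X) → Prop
  | id : IsPoly id
  | const_mul (a : X) {f : X → X} : IsPoly f → IsPoly (fun x => a * f x)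
  | mul_const (a : X) {f : X → X} : IsPoly f → IsPoly (fun x => f x * a)
  | mul {f g : X → X} : IsPoly f → IsPoly g → IsPoly (fun x => f x * g x)

theorem IsPoly.comp {f g : X → X} (hf : IsPoly f) (hg : IsPoly g) : IsPoly (f ∘ g) := by
  induction hf with
  | id => exact hg
  | const_mul a _ ih => exact ih.const_mul a
  | mul_const a _ ih => exact ih.mul_const a
  | mul _ _ ih₁ ih₂ => exact ih₁.mul ih₂

theorem IsPoly.continuous [TopologicalSpace X] [ContinuousMul X] {f : X → X} (hf : IsPoly f) :
    Continuous f := by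
  induction hf with
  | id => exact continuous_id
  | const_mul a _ ih => exact continuous_const.mul ih
  | mul_const a _ ih => exact ih.mul continuous_const
  | mul _ _ ih₁ ih₂ => exact ih₁.mul ih₂

theorem polyVal_singleton (a : WithOne X) (x : X) : polyVal [a] x = a := by
  simp [polyVal]

theorem polyVal_cons (a : WithOne X) {l : List (WithOne X)} (hl : l ≠ []) (x : X) :
    polyVal (a :: l) x = a * (x * polyVal l x) := by
  cases l with
  | nil => exact absurd rfl hl
  | cons b l => simp [polyVal, mul_assoc]

theorem exists_polyVal_mul {l₁ l₂ : List (WithOne X)} (h₁ : l₁ ≠ []) (h₂ : l₂ ≠ []) :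
    ∃ l : List (WithOne X), l.length + 1 = l₁.length + l₂.length ∧
      ∀ x, polyVal l x = polyVal l₁ x * polyVal l₂ x := by
  induction l₁ with
  | nil => exact absurd rfl h₁
  | cons a l₁ ih =>
    rcases eq_or_ne l₁ [] with rfl | h
    · cases l₂ with
      | nil => exact absurd rfl h₂
      | cons b l₂ =>
        refine ⟨(a * b) :: l₂, by simp; omega, fun x => ?_⟩
        simp [polyVal, mul_assoc]
    · obtain ⟨l, hl, hlx⟩ := ih h
      have h2 := List.length_pos_iff.2 h
      have h3 := List.length_pos_iff.2 h₂
      have hne : l ≠ [] := List.length_pos_iff.1 (by omega)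
      refine ⟨a :: l, by simp; omega, fun x => ?_⟩
      rw [polyVal_cons a hne, polyVal_cons a h, hlx]
      simp only [mul_assoc]

theorem IsPoly.exists_polyVal {f : X → X} (hf : IsPoly f) :
    ∃ l : List (WithOne X), 2 ≤ l.length ∧ ∀ x, polyVal l x = (f x : WithOne X) := by
  induction hf with
  | id => exact ⟨[1, 1], by simp, fun x => by simp [polyVal]⟩
  | const_mul a _ ih =>
    obtain ⟨l, hl, h⟩ := ih
    obtain ⟨m, hm, h'⟩ := exists_polyVal_mul (l₁ := [(a : WithOne X)]) (by simp)
      (List.length_pos_iff.1 (by omega : 0 < l.length))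
    refine ⟨m, by simp at hm; omega, fun x => ?_⟩
    rw [h', h, polyVal_singleton, WithOne.coe_mul]
  | mul_const a _ ih =>
    obtain ⟨l, hl, h⟩ := ih
    obtain ⟨m, hm, h'⟩ := exists_polyVal_mul (l₂ := [(a : WithOne X)])
      (List.length_pos_iff.1 (by omega : 0 < l.length)) (by simp)
    refine ⟨m, by simp at hm; omega, fun x => ?_⟩
    rw [h', h, polyVal_singleton, WithOne.coe_mul]
  | mul _ _ ih₁ ih₂ =>
    obtain ⟨l₁, hl₁, h₁⟩ := ih₁
    obtain ⟨l₂, hl₂, h₂⟩ := ih₂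
    obtain ⟨m, hm, h'⟩ := exists_polyVal_mul (List.length_pos_iff.1 (by omega : 0 < l₁.length))
      (List.length_pos_iff.1 (by omega : 0 < l₂.length))
    refine ⟨m, by omega, fun x => ?_⟩
    rw [h', h₁, h₂, WithOne.coe_mul]

theorem exists_isPoly_mul_polyVal (l : List (WithOne X)) {f : X → X} (hf : IsPoly f) :
    ∃ g : X → X, IsPoly g ∧ ∀ x, (f x : WithOne X) * polyVal l x = (g x : WithOne X) := by
  have hright : ∀ (a : WithOne X) {f : X → X}, IsPoly f →
      ∃ g : X → X, IsPoly g ∧ ∀ x, (f x : WithOne X) * a = (g x : WithOne X) := by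
    intro a f hf
    induction a with
    | one => exact ⟨f, hf, fun x => mul_one _⟩
    | coe a => exact ⟨_, hf.mul_const a, fun x => rfl⟩
  induction l generalizing f with
  | nil => exact ⟨f, hf, fun x => by simp [polyVal]⟩
  | cons a l ih =>
    obtain ⟨g, hg, hgx⟩ := hright a hf
    rcases eq_or_ne l [] with rfl | h
    · exact ⟨g, hg, fun x => by rw [polyVal_singleton, hgx]⟩
    · obtain ⟨k, hk, hkx⟩ := ih (hg.mul IsPoly.id)
      refine ⟨k, hk, fun x => ?_⟩
      rw [polyVal_cons a h, ← hkx, WithOne.coe_mul, ← hgx]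
      simp only [mul_assoc, id_eq]

theorem exists_isPoly_of_polyVal {l : List (WithOne X)} (hl : 2 ≤ l.length) :
    ∃ f : X → X, IsPoly f ∧ ∀ x, polyVal l x = (f x : WithOne X) := by
  match l, hl with
  | a :: b :: l, _ =>
    obtain ⟨f, hf, hfx⟩ := exists_isPoly_mul_polyVal (b :: l) (IsPoly.id (X := X))
    induction a with
    | one =>
      exact ⟨f, hf, fun x => by rw [polyVal_cons _ (by simp), one_mul, ← hfx]; rfl⟩
    | coe a =>
      exact ⟨_, hf.const_mul a, fun x => by
        rw [polyVal_cons _ (by simp), WithOne.coe_mul, ← hfx]; rfl⟩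

theorem isAlgebraicSet_iff {A : Set X} :
    IsAlgebraicSet A ↔ ∃ (f : X → X) (b : X), IsPoly f ∧ A = {x | f x = b} := by
  constructor
  · rintro ⟨l, b, hl, rfl⟩
    obtain ⟨f, hf, hfx⟩ := exists_isPoly_of_polyVal hl
    exact ⟨f, b, hf, by simp only [hfx, WithOne.coe_inj]⟩
  · rintro ⟨f, b, hf, rfl⟩
    obtain ⟨l, hl, hlx⟩ := hf.exists_polyVal
    exact ⟨l, b, hl, by simp only [hlx, WithOne.coe_inj]⟩

theorem isAlgebraicSet_singleton (b : X) : IsAlgebraicSet ({b} : Set X) :=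
  isAlgebraicSet_iff.2 ⟨id, b, IsPoly.id, rfl⟩

theorem IsAlgebraicSet.preimage {A : Set X} (hA : IsAlgebraicSet A) {f : X → X} (hf : IsPoly f) :
    IsAlgebraicSet (f ⁻¹' A) := by
  obtain ⟨g, b, hg, rfl⟩ := isAlgebraicSet_iff.1 hA
  exact isAlgebraicSet_iff.2 ⟨g ∘ f, b, hg.comp hf, rfl⟩

theorem IsAlgebraicSet.isClosed [TopologicalSpace X] [ContinuousMul X] [T1Space X] {A : Set X}
    (hA : IsAlgebraicSet A) : IsClosed A := by
  obtain ⟨f, b, hf, rfl⟩ := isAlgebraicSet_iff.1 hA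
  exact isClosed_singleton.preimage hf.continuous

theorem IsAlgebraicSet.polyboundedIn {A : Set X} (hA : IsAlgebraicSet A) : PolyboundedIn A :=
  ⟨{A}, Set.finite_singleton A, by simpa using hA, by simp⟩

theorem PolyboundedIn.mono {S T : Set X} (hST : S ⊆ T) (hT : PolyboundedIn T) :
    PolyboundedIn S := by
  obtain ⟨C, hC, hA, hT⟩ := hT
  exact ⟨C, hC, hA, hST.trans hT⟩

theorem PolyboundedIn.biUnion {ι : Type*} {s : Set ι} (hs : s.Finite) {S : ι → Set X}
    (h : ∀ i ∈ s, PolyboundedIn (S i)) : PolyboundedIn (⋃ i ∈ s, S i) := by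
  choose! C hC hA hS using h
  refine ⟨⋃ i ∈ s, C i, hs.biUnion hC, ?_, ?_⟩
  · intro A hA'
    obtain ⟨i, hi, hAi⟩ := Set.mem_iUnion₂.1 hA'
    exact hA i hi A hAi
  · refine Set.iUnion₂_subset fun i hi => (hS i hi).trans (Set.sUnion_subset_sUnion ?_)
    exact Set.subset_biUnion_of_mem (u := C) hi

theorem PolyboundedIn.preimage {S : Set X} (hS : PolyboundedIn S) {f : X → X} (hf : IsPoly f) :
    PolyboundedIn (f ⁻¹' S) := by
  obtain ⟨C, hC, hA, hS⟩ := hS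
  refine ⟨(f ⁻¹' ·) '' C, hC.image _, ?_, ?_⟩
  · rintro _ ⟨A, hAC, rfl⟩
    exact (hA A hAC).preimage hf
  · intro x hx
    obtain ⟨A, hAC, hxA⟩ := hS hx
    exact ⟨_, ⟨A, hAC, rfl⟩, hxA⟩

theorem IsPoly.map_mem {K : Set X} (hK : IsIdeal K) {f : X → X} (hf : IsPoly f) {x : X}
    (hx : x ∈ K) : f x ∈ K := by
  induction hf with
  | id => exact hx
  | const_mul a _ ih => exact (hK _ ih a).2
  | mul_const a _ ih => exact (hK _ ih a).1
  | mul _ _ ih _ => exact (hK _ ih _).1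

theorem IsIdeal.inter {I J : Set X} (hI : IsIdeal I) (hJ : IsIdeal J) : IsIdeal (I ∩ J) :=
  fun x hx a => ⟨⟨(hI x hx.1 a).1, (hJ x hx.2 a).1⟩, ⟨(hI x hx.1 a).2, (hJ x hx.2 a).2⟩⟩

theorem exists_avoiding_of_not_polybounded {K O : Set X} (hne : K.Nonempty) (hK : IsIdeal K)
    (hO : PolyboundedIn (O ∩ K)) (hX : ¬ Polybounded X) {F : Set (X → X)} (hF : F.Finite)
    (hpoly : ∀ f ∈ F, IsPoly f) : ∃ z ∈ K, ∀ f ∈ F, f z ∉ O := by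
  by_contra! h
  obtain ⟨c, hc⟩ := hne
  refine hX (PolyboundedIn.mono (fun x _ => ?_) (PolyboundedIn.biUnion hF fun f hf =>
    hO.preimage ((hpoly f hf).comp (IsPoly.id.const_mul c))))
  have hcx : c * x ∈ K := (hK c hc x).1
  obtain ⟨f, hf, hfO⟩ := h _ hcx
  exact Set.mem_iUnion₂.2 ⟨f, hf, hfO, (hpoly f hf).map_mem hK hcx⟩

/-- The polynomials obtained from the identity by `j` rounds of multiplying with each other and
with coefficients from `E`. -/
def polyLevel (E : Set X) : ℕ → Set (X → X)
  | 0 => {id}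
  | j + 1 => polyLevel E j ∪ polyLevel E j * polyLevel E j ∪
      ((Function.const X '' E) * polyLevel E j ∪ polyLevel E j * (Function.const X '' E))

theorem monotone_polyLevel (E : Set X) : Monotone (polyLevel E) :=
  monotone_nat_of_le_succ fun _ => Set.subset_union_left.trans Set.subset_union_left

theorem mul_mem_polyLevel {E : Set X} {j : ℕ} {f g : X → X} (hf : f ∈ polyLevel E j)
    (hg : g ∈ polyLevel E j) : f * g ∈ polyLevel E (j + 1) :=
  Or.inl (Or.inr (Set.mul_mem_mul hf hg))

theorem const_mul_mem_polyLevel {E : Set X} {j : ℕ} {f : X → X} {a : X} (ha : a ∈ E)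
    (hf : f ∈ polyLevel E j) : (Function.const X a) * f ∈ polyLevel E (j + 1) :=
  Or.inr (Or.inl (Set.mul_mem_mul (Set.mem_image_of_mem _ ha) hf))

theorem mul_const_mem_polyLevel {E : Set X} {j : ℕ} {f : X → X} {a : X} (ha : a ∈ E)
    (hf : f ∈ polyLevel E j) : f * (Function.const X a) ∈ polyLevel E (j + 1) :=
  Or.inr (Or.inr (Set.mul_mem_mul hf (Set.mem_image_of_mem _ ha)))

theorem id_mem_polyLevel (E : Set X) (j : ℕ) : id ∈ polyLevel E j :=
  monotone_polyLevel E (Nat.zero_le j) rfl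

theorem isPoly_of_mem_polyLevel {E : Set X} {j : ℕ} {f : X → X} (hf : f ∈ polyLevel E j) :
    IsPoly f := by
  induction j generalizing f with
  | zero => rw [Set.mem_singleton_iff.1 hf]; exact IsPoly.id
  | succ j ih =>
    rcases hf with (hf | ⟨g, hg, h, hh, rfl⟩) | ⟨_, ⟨a, _, rfl⟩, h, hh, rfl⟩ |
      ⟨h, hh, _, ⟨a, _, rfl⟩, rfl⟩
    · exact ih hf
    · exact (ih hg).mul (ih hh)
    · exact (ih hh).const_mul a
    · exact (ih hh).mul_const a

theorem finite_polyLevel {E : Set X} (hE : E.Finite) (j : ℕ) : (polyLevel E j).Finite := by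
  induction j with
  | zero => exact Set.finite_singleton _
  | succ j ih =>
    exact (ih.union (ih.mul ih)).union (((hE.image _).mul ih).union (ih.mul (hE.image _)))

theorem mk_polyLevel_le {E : Set X} {c : Cardinal.{u}} (hc : ℵ₀ ≤ c) (hE : #E ≤ c) (j : ℕ) :
    #(polyLevel E j) ≤ c := by
  have hmul : ∀ {S T : Set (X → X)}, #S ≤ c → #T ≤ c → #(S * T : Set (X → X)) ≤ c := by
    intro S T hS hT
    exact Cardinal.mk_mul_le.trans (Cardinal.mul_le_of_le hc hS hT)
  have hunion : ∀ {S T : Set (X → X)}, #S ≤ c → #T ≤ c → #(S ∪ T : Set (X → X)) ≤ c := by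
    intro S T hS hT
    exact (Cardinal.mk_union_le S T).trans (Cardinal.add_le_of_le hc hS hT)
  have hconst : #(Function.const X '' E) ≤ c := Cardinal.mk_image_le.trans hE
  induction j with
  | zero => exact (Cardinal.mk_singleton _).trans_le (Cardinal.one_le_aleph0.trans hc)
  | succ j ih => exact hunion (hunion ih (hmul ih ih)) (hunion (hmul hconst ih) (hmul ih hconst))

end Polynomials

section ZeroExtension

open Filter Topology

/-- A semigroup `X` has a zero filter if it is not closed in its `0`-extension for some Hausdorff
semigroup topology in which every point of `X` is isolated: the filter is the trace of the
neighborhoods of `0`. -/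
def HasZeroFilter (X : Type u) [Semigroup X] : Prop :=
  ∃ F : Filter X, F.NeBot ∧ (∀ x, {x}ᶜ ∈ F) ∧ (∀ x, Tendsto (x * ·) F F) ∧
    (∀ x, Tendsto (· * x) F F) ∧ Tendsto (fun p : X × X => p.1 * p.2) (F ×ˢ F) F

variable {X : Type u} [Semigroup X]

theorem continuousMul_withZero [TopologicalSpace (WithZero X)] {F : Filter X}
    (h0 : 𝓝 (0 : WithZero X) = pure 0 ⊔ F.map (↑))
    (hx : ∀ x : X, 𝓝 (x : WithZero X) = pure (x : WithZero X))
    (hl : ∀ x, Tendsto (x * ·) F F) (hr : ∀ x, Tendsto (· * x) F F)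
    (hm : Tendsto (fun p : X × X => p.1 * p.2) (F ×ˢ F) F) : ContinuousMul (WithZero X) := by
  refine ⟨continuous_iff_continuousAt.2 ?_⟩
  rintro ⟨a, b⟩
  rw [ContinuousAt, nhds_prod_eq]
  have hzl : ∀ l : Filter (WithZero X),
      Tendsto (fun p : WithZero X × WithZero X => p.1 * p.2) (pure 0 ×ˢ l) (𝓝 0) := by
    intro l
    rw [pure_prod, tendsto_map'_iff]
    exact tendsto_const_nhds.congr fun y => (zero_mul y).symm
  have hzr : ∀ l : Filter (WithZero X),
      Tendsto (fun p : WithZero X × WithZero X => p.1 * p.2) (l ×ˢ pure 0) (𝓝 0) := by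
    intro l
    rw [prod_pure, tendsto_map'_iff]
    exact tendsto_const_nhds.congr fun y => (mul_zero y).symm
  have hG : Tendsto ((↑) : X → WithZero X) F (𝓝 0) := by
    rw [h0]
    exact tendsto_map.mono_right le_sup_right
  induction a with
  | zero =>
    rw [zero_mul]
    induction b with
    | zero =>
      nth_rewrite 1 2 [h0]
      rw [sup_prod, prod_sup (F.map _)]
      refine (hzl _).sup ((hzr _).sup ?_)
      rw [prod_map_map_eq, tendsto_map'_iff]
      exact (hG.comp hm).congr fun p => WithZero.coe_mul _ _
    | coe b =>
      rw [h0, hx, sup_prod, ← h0]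
      refine (hzl _).sup ?_
      rw [prod_pure, map_map, tendsto_map'_iff]
      exact (hG.comp (hr b)).congr fun y => WithZero.coe_mul y b
  | coe a =>
    induction b with
    | zero =>
      rw [mul_zero, h0, hx, prod_sup, ← h0]
      refine (hzr _).sup ?_
      rw [pure_prod, map_map, tendsto_map'_iff]
      exact (hG.comp (hl a)).congr fun y => WithZero.coe_mul a y
    | coe b =>
      rw [hx, hx, pure_prod, Filter.map_pure]
      exact tendsto_pure_left.2 fun s hs => mem_of_mem_nhds hs

theorem not_hasZeroFilter
    (hDiscr : ∀ (Y : Type u) [Semigroup Y] [TopologicalSpace Y],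
      ∀ [ContinuousMul Y] [T2Space Y], ∀ z : Y,
      ¬ IsOpen ({z} : Set Y) → (∀ y : Y, y ≠ z → IsOpen ({y} : Set Y)) →
      (∀ y : Y, z * y = z ∧ y * z = z) →
      ∀ f : X →ₙ* Y, Function.Injective f → IsClosed (Set.range f)) :
    ¬ HasZeroFilter X := by
  rintro ⟨F, hF, hpt, hl, hr, hm⟩
  let G : Filter (WithZero X) := F.map (↑)
  let _ : TopologicalSpace (WithZero X) := nhdsAdjoint 0 G
  have h0 : 𝓝 (0 : WithZero X) = pure 0 ⊔ G := nhds_nhdsAdjoint_same 0 G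
  have hx : ∀ x : X, 𝓝 (x : WithZero X) = pure (x : WithZero X) := fun x =>
    nhds_nhdsAdjoint_of_ne G WithZero.coe_ne_zero
  have hzero : ¬ IsOpen ({0} : Set (WithZero X)) := by
    intro h
    have h1 := h.mem_nhds rfl
    rw [h0] at h1
    have h2 : ((↑) : X → WithZero X) ⁻¹' {0} ∈ F := h1.2
    have h3 : ((↑) : X → WithZero X) ⁻¹' {0} = ∅ := by ext; simp
    exact F.empty_notMem (h3 ▸ h2)
  have hiso : ∀ y : WithZero X, y ≠ 0 → IsOpen ({y} : Set (WithZero X)) := fun y hy =>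
    isOpen_singleton_nhdsAdjoint G hy
  have hsep : ∀ x : X, Disjoint (𝓝 (0 : WithZero X)) (𝓝 (x : WithZero X)) := by
    intro x
    rw [h0, hx, Filter.disjoint_iff]
    refine ⟨{(x : WithZero X)}ᶜ, ⟨?_, ?_⟩, {(x : WithZero X)}, mem_pure.2 rfl,
      disjoint_compl_left⟩
    · exact mem_pure.2 WithZero.coe_ne_zero.symm
    · exact mem_map.2 <| mem_of_superset (hpt x) fun y hy h => hy (WithZero.coe_injective h)
  have : T2Space (WithZero X) := by
    rw [t2Space_iff_disjoint_nhds]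
    intro a b hab
    induction a with
    | zero =>
      induction b with
      | zero => exact absurd rfl hab
      | coe b => exact hsep b
    | coe a =>
      induction b with
      | zero => exact (hsep a).symm
      | coe b => rw [hx, hx]; exact disjoint_pure_pure.2 hab
  have : ContinuousMul (WithZero X) := continuousMul_withZero h0 hx hl hr hm
  have hcl := hDiscr (WithZero X) 0 hzero hiso (fun y => ⟨zero_mul y, mul_zero y⟩)
    ⟨(↑), fun a b => WithZero.coe_mul a b⟩ WithZero.coe_injective
  apply hzero
  rw [← isClosed_compl_iff]
  convert hcl using 1
  ext y
  induction y with
  | zero => simp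
  | coe y => simp

theorem hasZeroFilter_of_directed {ι : Type*} [Nonempty ι] (U : ι → Set X)
    (hdir : Directed (· ⊇ ·) U) (hne : ∀ i, (U i).Nonempty) (hpt : ∀ x, ∃ i, x ∉ U i)
    (hmul : ∀ i, ∃ j, ∀ x ∈ U j, ∀ y ∈ U j, x * y ∈ U i)
    (htrans : ∀ x i, ∃ j, ∀ y ∈ U j, x * y ∈ U i ∧ y * x ∈ U i) : HasZeroFilter X := by
  have hb : (⨅ i, 𝓟 (U i)).HasBasis (fun _ => True) U := hasBasis_iInf_principal hdir
  refine ⟨⨅ i, 𝓟 (U i), hb.neBot_iff.2 fun {_} _ => hne _, fun x => ?_, fun x => ?_,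
    fun x => ?_, ?_⟩
  · obtain ⟨i, hi⟩ := hpt x
    exact hb.mem_iff.2 ⟨i, trivial, fun y hy h => hi (h ▸ hy)⟩
  · refine hb.tendsto_iff hb |>.2 fun i _ => ?_
    obtain ⟨j, hj⟩ := htrans x i
    exact ⟨j, trivial, fun y hy => (hj y hy).1⟩
  · refine hb.tendsto_iff hb |>.2 fun i _ => ?_
    obtain ⟨j, hj⟩ := htrans x i
    exact ⟨j, trivial, fun y hy => (hj y hy).2⟩
  · refine hb.prod_self.tendsto_iff hb |>.2 fun i _ => ?_
    obtain ⟨j, hj⟩ := hmul i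
    exact ⟨j, trivial, fun p hp => hj _ hp.1 _ hp.2⟩

end ZeroExtension

section Generic

/-- The state reached after reading `k` binary digits of `x` past the radix point: every block
`0 ⋯ 0 1` of digits `1 0ᵐ⁺¹ 1` triggers the transition `step m`. -/
noncomputable def digitState {S : Type*} (s₀ : S) (step : ℕ → S → S) (x : ℝ) : ℕ → S
  | 0 => s₀
  | k + 1 => match padicValInt 2 (⌊x * 2 ^ (k + 1)⌋ - 1) with
    | 0 => digitState s₀ step x k
    | m + 1 => step m (digitState s₀ step x k)

theorem floor_mul_two_pow_sub (x : ℝ) (k t : ℕ) :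
    ⌊x * 2 ^ k⌋ = ⌊x * 2 ^ (k + t)⌋ / 2 ^ t := by
  have h := Int.floor_div_natCast (x * 2 ^ (k + t)) (2 ^ t)
  push_cast at h
  rw [← h, pow_add, ← mul_assoc, mul_div_cancel_right₀ _ (by positivity)]

theorem digitState_congr {S : Type*} (s₀ : S) (step : ℕ → S → S) {x y : ℝ} {k : ℕ}
    (h : ⌊x * 2 ^ k⌋ = ⌊y * 2 ^ k⌋) : digitState s₀ step x k = digitState s₀ step y k := by
  induction k with
  | zero => rfl
  | succ k ih =>
    have h' : ⌊x * 2 ^ k⌋ = ⌊y * 2 ^ k⌋ := by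
      rw [floor_mul_two_pow_sub x k 1, floor_mul_two_pow_sub y k 1, h]
    simp only [digitState, h, ih h']

theorem digitState_of_even {S : Type*} (s₀ : S) (step : ℕ → S → S) {x : ℝ} {k : ℕ}
    (h : Even ⌊x * 2 ^ (k + 1)⌋) : digitState s₀ step x (k + 1) = digitState s₀ step x k := by
  have h0 : padicValInt 2 (⌊x * 2 ^ (k + 1)⌋ - 1) = 0 :=
    padicValInt.eq_zero_of_not_dvd (by
      obtain ⟨r, hr⟩ := h
      push_cast
      omega)
  simp only [digitState, h0]

theorem digitState_of_floor_eq {S : Type*} (s₀ : S) (step : ℕ → S → S) {x : ℝ} {k m : ℕ} {a : ℤ}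
    (ha : Odd a) (h : ⌊x * 2 ^ (k + m + 1)⌋ = 2 ^ (m + 1) * a + 1) :
    digitState s₀ step x (k + m + 1) = step m (digitState s₀ step x k) := by
  have hfloor : ∀ t ≤ m, ⌊x * 2 ^ (k + t)⌋ = 2 ^ t * a := by
    intro t ht
    obtain ⟨r, rfl⟩ := Nat.exists_eq_add_of_le ht
    rw [floor_mul_two_pow_sub x (k + t) (r + 1), show k + t + (r + 1) = k + (t + r) + 1 by ring, h]
    rw [show (2 : ℤ) ^ (t + r + 1) * a + 1 = 1 + 2 ^ (r + 1) * (2 ^ t * a) by ring,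
      Int.add_mul_ediv_left _ _ (by positivity), Int.ediv_eq_zero_of_lt (by norm_num), zero_add]
    exact one_lt_pow₀ (by norm_num) (by omega)
  have hconst : ∀ t ≤ m, digitState s₀ step x (k + t) = digitState s₀ step x k := by
    intro t ht
    induction t with
    | zero => rfl
    | succ t ih =>
      rw [← ih (by omega)]
      have heven : Even ⌊x * 2 ^ (k + t + 1)⌋ := by
        rw [add_assoc, hfloor (t + 1) ht, pow_succ', mul_assoc]
        exact even_two_mul _
      exact digitState_of_even s₀ step heven
  have hval : padicValInt 2 (⌊x * 2 ^ (k + m + 1)⌋ - 1) = m + 1 := by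
    have ha0 : a ≠ 0 := by rintro rfl; simp at ha
    rw [h, add_sub_cancel_right, padicValInt.mul (by positivity) ha0,
      padicValInt.eq_zero_of_not_dvd (z := a), padicValInt, Int.natAbs_pow]
    · simp
    · obtain ⟨r, hr⟩ := ha
      push_cast
      omega
  simp only [digitState, hval, hconst m le_rfl]

theorem isMeagre_of_step {S : Type*} (s₀ : S) (step : ℕ → S → S) {P : S → Prop}
    (hP : ∀ s, ∃ m, P (step m s)) : IsMeagre {x : ℝ | ∀ k, ¬ P (digitState s₀ step x k)} := by
  set M := {x : ℝ | ∀ k, ¬ P (digitState s₀ step x k)} with hM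
  have hdense : Dense (interior Mᶜ) := by
    refine dense_iff_inter_open.2 fun J hJ ⟨x₀, hx₀⟩ => ?_
    obtain ⟨ε, hε, hball⟩ := Metric.isOpen_iff.1 hJ x₀ hx₀
    obtain ⟨k, hk⟩ := exists_pow_lt_of_lt_one hε (by norm_num : (1 / 2 : ℝ) < 1)
    set a : ℤ := 2 * ⌊x₀ * 2 ^ k⌋ + 1 with ha
    obtain ⟨m, hm⟩ := hP (digitState s₀ step ((a : ℝ) / 2 ^ (k + 1)) (k + 1))
    set N : ℕ := k + 1 + m + 1 with hN
    set n : ℤ := 2 ^ (m + 1) * a + 1 with hn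
    have hpos : (0 : ℝ) < 2 ^ N := by positivity
    let I : Set ℝ := Set.Ioo ((n : ℝ) / 2 ^ N) ((n + 1 : ℝ) / 2 ^ N)
    have hfloor : ∀ x ∈ I, ⌊x * 2 ^ N⌋ = n := by
      rintro x ⟨h1, h2⟩
      rw [div_lt_iff₀ hpos] at h1
      rw [lt_div_iff₀ hpos] at h2
      exact Int.floor_eq_iff.2 ⟨h1.le, h2⟩
    have hfloor' : ∀ x ∈ I, ⌊x * 2 ^ (k + 1)⌋ = a := by
      intro x hx
      rw [floor_mul_two_pow_sub x (k + 1) (m + 1), ← add_assoc, hfloor x hx, hn, add_comm,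
        Int.add_mul_ediv_left _ _ (by positivity), Int.ediv_eq_zero_of_lt (by norm_num), zero_add]
      exact one_lt_pow₀ (by norm_num) (by omega)
    have hIJ : I ⊆ J := by
      intro x hx
      refine hball ?_
      have h1 : ⌊x * 2 ^ k⌋ = ⌊x₀ * 2 ^ k⌋ := by
        rw [floor_mul_two_pow_sub x k 1, hfloor' x hx, ha]
        omega
      have h2 := Int.abs_sub_lt_one_of_floor_eq_floor h1
      rw [← sub_mul, abs_mul, abs_of_pos (by positivity : (0 : ℝ) < 2 ^ k)] at h2
      rw [Metric.mem_ball, Real.dist_eq]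
      refine lt_trans ?_ hk
      rwa [one_div, inv_pow, ← one_div, lt_div_iff₀ (by positivity)]
    have hIM : I ⊆ Mᶜ := by
      intro x hx h
      refine h N ?_
      rw [hN, digitState_of_floor_eq s₀ step (a := a) ⟨_, ha⟩ (hfloor x hx)]
      convert hm using 2
      refine digitState_congr s₀ step ?_
      rw [hfloor' x hx, div_mul_cancel₀ _ (by positivity), Int.floor_intCast]
    have hne : I.Nonempty := Set.nonempty_Ioo.2 (by gcongr; linarith)
    obtain ⟨x, hx⟩ := hne
    exact ⟨x, hIJ hx, interior_maximal hIM isOpen_Ioo hx⟩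
  exact Filter.mem_of_superset (residual_of_dense_open isOpen_interior hdense) interior_subset

theorem exists_generic_sequence {S : Type*} {ι : Type u} (hι : #ι < Cardinal.lift.{u} covMeager)
    (s₀ : S) (step : ℕ → S → S) (P : ι → ℕ → S → Prop) (hP : ∀ i n s, ∃ m, P i n (step m s)) :
    ∃ σ : ℕ → S, (∀ k, σ (k + 1) = σ k ∨ ∃ m, σ (k + 1) = step m (σ k)) ∧
      ∀ i n, ∃ k, P i n (σ k) := by
  let M : ι → Set ℝ := fun i => ⋃ n, {x | ∀ k, ¬ P i n (digitState s₀ step x k)}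
  have hM : ∀ i, IsMeagre (M i) := fun i =>
    isMeagre_iUnion fun n => isMeagre_of_step s₀ step (hP i n)
  have hcover : ⋃₀ Set.range M ≠ Set.univ := by
    intro h
    have h1 : covMeager ≤ #(Set.range M) :=
      csInf_le' ⟨Set.range M, by rintro _ ⟨i, rfl⟩; exact hM i, h, rfl⟩
    have h2 := Cardinal.mk_range_le_lift (f := M)
    rw [Cardinal.lift_uzero] at h2
    exact absurd ((Cardinal.lift_le.2 h1).trans h2) (not_le.2 hι)
  obtain ⟨x, hx⟩ := (Set.ne_univ_iff_exists_notMem _).1 hcover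
  refine ⟨digitState s₀ step x, fun k => ?_, fun i n => ?_⟩
  · simp only [digitState]
    split
    · exact Or.inl rfl
    · exact Or.inr ⟨_, rfl⟩
  · by_contra! h
    exact hx ⟨M i, ⟨i, rfl⟩, Set.mem_iUnion.2 ⟨n, h⟩⟩

theorem aleph0_lt_covMeager : ℵ₀ < covMeager := by
  obtain ⟨S, hS, hcov, hc⟩ : covMeager ∈ {c : Cardinal | ∃ S : Set (Set ℝ),
      (∀ A ∈ S, IsMeagre A) ∧ ⋃₀ S = Set.univ ∧ Cardinal.mk ↥S = c} := by
    refine csInf_mem ⟨_, Set.range (fun x : ℝ => {x}), ?_, ?_, rfl⟩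
    · rintro _ ⟨x, rfl⟩
      refine IsNowhereDense.isMeagre ?_
      simp [IsNowhereDense]
    · exact Set.eq_univ_of_forall fun x => ⟨{x}, ⟨x, rfl⟩, rfl⟩
  rw [← hc]
  by_contra h
  have hcount : S.Countable := Cardinal.mk_le_aleph0_iff.1 (not_lt.1 h)
  have hmeagre : IsMeagre (⋃₀ S) := by
    rw [Set.sUnion_eq_biUnion]
    exact isMeagre_biUnion hcount hS
  exact not_isMeagre_of_isOpen isOpen_univ Set.univ_nonempty (hcov ▸ hmeagre)

end Generic

section BaireCategory

open Filter Topology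

/-- In a nonempty complete separable metric space, a closed cover of cardinality less than
`cov(M)` has a member with nonempty interior. -/
theorem exists_nonempty_interior_of_mk_lt {Z : Type*} [MetricSpace Z] [CompleteSpace Z]
    [TopologicalSpace.SeparableSpace Z] [Nonempty Z] {ι : Type u}
    (hι : #ι < Cardinal.lift.{u} covMeager) {A : ι → Set Z} (hA : ∀ i, IsClosed (A i))
    (hcov : ⋃ i, A i = Set.univ) : ∃ i, (interior (A i)).Nonempty := by
  classical
  by_contra! hint
  let S := Z × {r : ℝ // 0 < r}
  let B : S → Set Z := fun s => Metric.closedBall s.1 s.2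
  let next : ℕ → S := fun m =>
    (TopologicalSpace.denseSeq Z m.unpair.1, ⟨(1 / 2) ^ m.unpair.2, by positivity⟩)
  let step : ℕ → S → S := fun m s =>
    if B (next m) ⊆ B s then next m else s
  let P : ι → ℕ → S → Prop := fun i n s => (s.2 : ℝ) ≤ 1 / (n + 1) ∧ Disjoint (B s) (A i)
  have hP : ∀ i n s, ∃ m, P i n (step m s) := by
    intro i n s
    have hne : (Metric.ball s.1 s.2 ∩ (A i)ᶜ).Nonempty := by
      rw [← Set.sdiff_eq, Set.nonempty_iff_ne_empty, Ne, Set.sdiff_eq_empty]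
      intro h
      have := interior_maximal h Metric.isOpen_ball (Metric.mem_ball_self s.2.2)
      rw [hint i] at this
      exact this
    obtain ⟨q, hq⟩ := hne
    obtain ⟨ε, hε, hball⟩ := Metric.isOpen_iff.1
      (Metric.isOpen_ball.inter (hA i).isOpen_compl) q hq
    obtain ⟨b, hb⟩ := exists_pow_lt_of_lt_one
      (lt_min (half_pos hε) (by positivity : (0 : ℝ) < 1 / (n + 1)))
      (by norm_num : (1 / 2 : ℝ) < 1)
    obtain ⟨hb1, hb2⟩ := lt_min_iff.1 hb
    obtain ⟨a, ha⟩ := (TopologicalSpace.denseRange_denseSeq Z).exists_dist_lt q (half_pos hε)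
    have hsub : B (next (Nat.pair a b)) ⊆ Metric.ball s.1 s.2 ∩ (A i)ᶜ := by
      refine Set.Subset.trans (fun y hy => ?_) hball
      simp only [B, next, Nat.unpair_pair, Metric.mem_closedBall] at hy
      rw [Metric.mem_ball]
      rw [dist_comm] at ha
      linarith [dist_triangle y (TopologicalSpace.denseSeq Z a) q]
    refine ⟨Nat.pair a b, ?_⟩
    have hstep : step (Nat.pair a b) s = next (Nat.pair a b) :=
      if_pos ((hsub.trans Set.inter_subset_left).trans Metric.ball_subset_closedBall)
    rw [hstep]
    refine ⟨?_, Set.disjoint_left.2 fun y hy => (hsub hy).2⟩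
    simp only [next, Nat.unpair_pair]
    exact hb2.le
  obtain ⟨σ, hσ, hgen⟩ := exists_generic_sequence hι
    ((Classical.arbitrary Z, ⟨1, one_pos⟩) : S) step P hP
  have hanti : Antitone fun k => B (σ k) := by
    refine antitone_nat_of_succ_le fun k => ?_
    rcases hσ k with h | ⟨m, h⟩
    · rw [h]
    · rw [h]
      simp only [step]
      split_ifs with hm
      · exact hm
      · exact le_rfl
  have hιne : Nonempty ι := by
    by_contra h
    rw [not_nonempty_iff] at h
    rw [Set.iUnion_of_empty] at hcov
    exact Set.empty_ne_univ hcov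
  obtain ⟨i₀⟩ := hιne
  have hdiam : Tendsto (fun k => Metric.diam (B (σ k))) atTop (𝓝 0) := by
    refine Metric.tendsto_atTop.2 fun ε hε => ?_
    obtain ⟨n, hn⟩ := exists_nat_one_div_lt (half_pos hε)
    obtain ⟨k, hk, -⟩ := hgen i₀ n
    refine ⟨k, fun l hl => ?_⟩
    rw [Real.dist_0_eq_abs, abs_of_nonneg Metric.diam_nonneg]
    have h1 := Metric.diam_mono (hanti hl) Metric.isBounded_closedBall
    have h2 : Metric.diam (B (σ k)) ≤ 2 * (σ k).2 := Metric.diam_closedBall (σ k).2.2.le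
    simp only at h1
    linarith
  obtain ⟨p, hp⟩ := Metric.nonempty_iInter_of_nonempty_biInter
    (fun k => (Metric.isClosed_closedBall : IsClosed (B (σ k))))
    (fun k => Metric.isBounded_closedBall)
    (fun N => ⟨(σ N).1, Set.mem_iInter₂.2 fun k hk =>
      hanti hk (Metric.mem_closedBall_self (σ N).2.2.le)⟩) hdiam
  obtain ⟨i, hi⟩ := Set.mem_iUnion.1 (hcov.symm ▸ Set.mem_univ p : p ∈ ⋃ i, A i)
  obtain ⟨k, -, hk⟩ := hgen i 0
  exact Set.disjoint_left.1 hk (Set.mem_iInter.1 hp k) hi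

end BaireCategory

section TransfiniteConstruction

variable {X : Type u} [Semigroup X]

theorem exists_avoiding_sequence [LinearOrder X] [WellFoundedLT X]
    (hord : Cardinal.ord #X = Ordinal.type (α := X) (· < ·)) (hX : ℵ₀ < #X)
    (havoid : ∀ C : Set (Set X), (∀ A ∈ C, IsAlgebraicSet A) → #C < #X → ∃ z, ∀ A ∈ C, z ∉ A) :
    ∃ (z : X → X) (E : X → Set X), (∀ γ, Set.Iic γ ⊆ E γ) ∧
      (∀ β γ, β < γ → ∀ j, ∀ f ∈ polyLevel (E β) j, f (z β) ∈ E γ) ∧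
      ∀ γ j, ∀ f ∈ polyLevel (E γ) j, ∀ β ≤ γ, f (z γ) ≠ β := by
  have hXne : Nonempty X := Cardinal.mk_ne_zero_iff.1 (ne_bot_of_gt hX)
  let coeff : (γ : X) → ((β : X) → β < γ → X × Set X) → Set X := fun γ ih =>
    Set.Iic γ ∪ ⋃ p : Set.Iio γ × ℕ, (fun f => f (ih p.1 p.1.2).1) '' polyLevel (ih p.1 p.1.2).2 p.2
  let good : X → Set X → X → Prop := fun γ E z =>
    ∀ j, ∀ f ∈ polyLevel E j, ∀ β ≤ γ, f z ≠ β
  let D : X → X × Set X := (wellFounded_lt (α := X)).fix fun γ ih =>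
    (Classical.epsilon (good γ (coeff γ ih)), coeff γ ih)
  have hD : ∀ γ, D γ = (Classical.epsilon (good γ (coeff γ fun β _ => D β)),
      coeff γ fun β _ => D β) := fun γ => WellFounded.fix_eq _ _ γ
  have hE : ∀ γ, (D γ).2 = Set.Iic γ ∪
      ⋃ p : Set.Iio γ × ℕ, (fun f => f (D p.1).1) '' polyLevel (D p.1).2 p.2 := fun γ => by
    rw [hD γ]
  have hz : ∀ γ, (D γ).1 = Classical.epsilon (good γ (D γ).2) := fun γ => by
    rw [hD γ]
  let c : X → Cardinal.{u} := fun γ => max ℵ₀ #(Set.Iio γ)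
  have hc : ∀ γ, ℵ₀ ≤ c γ := fun γ => le_max_left _ _
  have hcX : ∀ γ, c γ < #X := fun γ => max_lt hX (Cardinal.mk_Iio_lt γ hord)
  have hIic : ∀ γ, #(Set.Iic γ) ≤ c γ := by
    intro γ
    rw [← Set.Iio_union_right]
    refine (Cardinal.mk_union_le _ _).trans (Cardinal.add_le_of_le (hc γ) (le_max_right _ _) ?_)
    rw [Cardinal.mk_singleton]
    exact Cardinal.one_le_aleph0.trans (hc γ)
  have hcard : ∀ γ, #((D γ).2) ≤ c γ := by
    intro γ
    induction γ using WellFoundedLT.induction with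
    | ind γ ih =>
    rw [hE γ]
    refine (Cardinal.mk_union_le _ _).trans (Cardinal.add_le_of_le (hc γ) (hIic γ) ?_)
    refine (Cardinal.mk_iUnion_le _).trans (Cardinal.mul_le_of_le (hc γ) ?_ (ciSup_le' fun p => ?_))
    · rw [Cardinal.mk_prod, Cardinal.lift_uzero, Cardinal.mk_nat, Cardinal.lift_aleph0]
      exact Cardinal.mul_le_of_le (hc γ) (le_max_right _ _) (hc γ)
    · have hle : c p.1 ≤ c γ := max_le_max le_rfl
        (Cardinal.mk_le_mk_of_subset (Set.Iio_subset_Iio (le_of_lt p.1.2)))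
      exact Cardinal.mk_image_le.trans (mk_polyLevel_le (hc γ) ((ih p.1 p.1.2).trans hle) p.2)
  have hgood : ∀ γ, good γ (D γ).2 (D γ).1 := by
    intro γ
    rw [hz γ]
    refine Classical.epsilon_spec (p := good γ (D γ).2) ?_
    let F : Set (X → X) := ⋃ j : ULift.{u} ℕ, polyLevel (D γ).2 j.down
    have hF : #F ≤ c γ := by
      refine (Cardinal.mk_iUnion_le _).trans (Cardinal.mul_le_of_le (hc γ) ?_
        (ciSup_le' fun j => mk_polyLevel_le (hc γ) (hcard γ) j.down))
      simpa using hc γ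
    obtain ⟨z, hz⟩ := havoid (Set.image2 (fun f b => {x : X | f x = b}) F (Set.Iic γ))
      (by
        rintro _ ⟨f, hf, b, -, rfl⟩
        obtain ⟨j, hj⟩ := Set.mem_iUnion.1 hf
        exact isAlgebraicSet_iff.2 ⟨f, b, isPoly_of_mem_polyLevel hj, rfl⟩)
      ((Cardinal.mk_image2_le.trans (Cardinal.mul_le_of_le (hc γ) hF (hIic γ))).trans_lt (hcX γ))
    exact ⟨z, fun j f hf β hβ h =>
      hz _ ⟨f, Set.mem_iUnion.2 ⟨⟨j⟩, hf⟩, β, hβ, rfl⟩ h⟩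
  refine ⟨fun γ => (D γ).1, fun γ => (D γ).2, fun γ => ?_, fun β γ hβ j f hf => ?_, hgood⟩
  · simp only [hE γ]
    exact Set.subset_union_left
  · show f (D β).1 ∈ (D γ).2
    rw [hE γ]
    exact Or.inr (Set.mem_iUnion.2 ⟨(⟨β, hβ⟩, j), f, hf, rfl⟩)

theorem exists_algebraic_cover_mk_lt (hX : ℵ₀ < #X) (hzero : ¬ HasZeroFilter X) :
    ∃ C : Set (Set X), (∀ A ∈ C, IsAlgebraicSet A) ∧ ⋃₀ C = Set.univ ∧ #C < #X := by
  by_contra! hcov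
  obtain ⟨r, hwo, hr⟩ := Cardinal.exists_ord_eq X
  let _ : LinearOrder X := IsWellOrder.linearOrder r
  have : WellFoundedLT X := ⟨hwo.wf⟩
  have hXne : Nonempty X := Cardinal.mk_ne_zero_iff.1 (ne_bot_of_gt hX)
  obtain ⟨z, E, hIic, hmem, hne⟩ := exists_avoiding_sequence hr hX (fun C hC hlt => by
    by_contra! h
    exact absurd hlt (not_lt.2 (hcov C hC (Set.eq_univ_of_forall fun x => h x))))
  let U : X → Set X := fun γ => {x | ∃ δ, γ ≤ δ ∧ ∃ j, ∃ f ∈ polyLevel (E δ) j, f (z δ) = x}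
  have hanti : Antitone U := by
    rintro γ γ' h x ⟨δ, hδ, hx⟩
    exact ⟨δ, h.trans hδ, hx⟩
  refine hzero (hasZeroFilter_of_directed U hanti.directed_ge
    (fun γ => ⟨z γ, γ, le_rfl, 0, id, id_mem_polyLevel _ _, rfl⟩) (fun x => ⟨x, ?_⟩)
    (fun γ => ⟨γ, ?_⟩) (fun x γ => ⟨max x γ, ?_⟩))
  · rintro ⟨δ, hδ, j, f, hf, h⟩
    exact hne δ j f hf x hδ h
  · rintro _ ⟨δ, hδ, j, f, hf, rfl⟩ _ ⟨ε, hε, k, g, hg, rfl⟩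
    rcases lt_trichotomy δ ε with h | rfl | h
    · exact ⟨ε, hε, k + 1, _, const_mul_mem_polyLevel (hmem δ ε h j f hf) hg, rfl⟩
    · exact ⟨δ, hδ, max j k + 1, _,
        mul_mem_polyLevel (monotone_polyLevel _ (le_max_left j k) hf)
          (monotone_polyLevel _ (le_max_right j k) hg), rfl⟩
    · exact ⟨δ, hδ, j + 1, _, mul_const_mem_polyLevel (hmem ε δ h k g hg) hf, rfl⟩
  · rintro _ ⟨δ, hδ, j, f, hf, rfl⟩
    have hx : x ∈ E δ := hIic δ ((le_max_left x γ).trans hδ)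
    have hγ : γ ≤ δ := (le_max_right x γ).trans hδ
    exact ⟨⟨δ, hγ, j + 1, _, const_mul_mem_polyLevel hx hf, rfl⟩,
      ⟨δ, hγ, j + 1, _, mul_const_mem_polyLevel hx hf, rfl⟩⟩

end TransfiniteConstruction

section SubinvariantMetric

open Filter Topology

variable {X : Type u} [Semigroup X] [MetricSpace X]

theorem Subinvariant.dist_mul_mul_le (hsub : Subinvariant (fun x y : X => dist x y))
    (a b c d : X) : dist (a * b) (c * d) ≤ dist a c + dist b d :=
  (dist_triangle _ (c * b) _).trans (add_le_add (hsub.2 b a c) (hsub.1 c b d))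

theorem Subinvariant.uniformContinuous_mul (hsub : Subinvariant (fun x y : X => dist x y)) :
    UniformContinuous (fun p : X × X => p.1 * p.2) := by
  refine (LipschitzWith.of_dist_le_mul (K := 2) fun p q => ?_).uniformContinuous
  refine (hsub.dist_mul_mul_le _ _ _ _).trans ?_
  rw [NNReal.coe_ofNat, two_mul, Prod.dist_eq]
  exact add_le_add (le_max_left _ _) (le_max_right _ _)

theorem Subinvariant.continuousMul (hsub : Subinvariant (fun x y : X => dist x y)) :
    ContinuousMul X :=
  ⟨hsub.uniformContinuous_mul.continuous⟩

theorem Subinvariant.completeSpace [TopologicalSpace.SeparableSpace X]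
    (hsub : Subinvariant (fun x y : X => dist x y))
    (hPolish : ∀ (Y : Type u) [Semigroup Y] [TopologicalSpace Y],
      ∀ [ContinuousMul Y] [PolishSpace Y],
      ∀ f : X →ₙ* Y, Function.Injective f → IsClosed (Set.range f)) : CompleteSpace X := by
  have hu : UniformContinuous₂ ((· * ·) : X → X → X) := hsub.uniformContinuous_mul
  let Y := UniformSpace.Completion X
  let m : Y → Y → Y := UniformSpace.Completion.map₂ (· * ·)
  have hm : Continuous fun p : Y × Y => m p.1 p.2 :=
    UniformSpace.Completion.continuous_map₂ continuous_fst continuous_snd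
  have hcoe : ∀ a b : X, m a b = ((a * b : X) : Y) := fun a b =>
    UniformSpace.Completion.map₂_coe_coe a b _ hu
  have hmc : ∀ {f g : Y × Y × Y → Y}, Continuous f → Continuous g →
      Continuous fun p => m (f p) (g p) := fun hf hg => hm.comp (hf.prodMk hg)
  let _ : Semigroup Y :=
    { mul := m
      mul_assoc := fun a b c => by
        show m (m a b) c = m a (m b c)
        refine UniformSpace.Completion.induction_on₃ a b c (isClosed_eq ?_ ?_) fun a b c => ?_
        · exact hmc (hmc continuous_fst (continuous_fst.comp continuous_snd))
            (continuous_snd.comp continuous_snd)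
        · exact hmc continuous_fst (hmc (continuous_fst.comp continuous_snd)
            (continuous_snd.comp continuous_snd))
        · simp only [hcoe, mul_assoc] }
  have : ContinuousMul Y := ⟨hm⟩
  have hcl := hPolish Y ⟨fun x => (x : Y), fun a b => (hcoe a b).symm⟩
    (UniformSpace.Completion.coe_injective X)
  exact (completeSpace_iff_isComplete_range
    (UniformSpace.Completion.isUniformInducing_coe X)).2 hcl.isComplete

theorem exists_monotone_polyboundedIn [TopologicalSpace.SeparableSpace X] {K : Set X}
    (hloc : ∀ p ∈ K, ∃ O, IsOpen O ∧ p ∈ O ∧ PolyboundedIn (O ∩ K)) :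
    ∃ O : ℕ → Set X, Monotone O ∧ (∀ k, IsOpen (O k)) ∧ (K ⊆ ⋃ k, O k) ∧
      ∀ k, PolyboundedIn (O k ∩ K) := by
  have : SecondCountableTopology X := UniformSpace.secondCountable_of_separable X
  obtain ⟨T, hT, hTS, hTU⟩ := TopologicalSpace.isOpen_sUnion_countable
    {O : Set X | IsOpen O ∧ PolyboundedIn (O ∩ K)} fun O hO => hO.1
  obtain ⟨V, hV⟩ := (hT.insert ∅).exists_eq_range (Set.insert_nonempty _ _)
  have hVmem : ∀ n, IsOpen (V n) ∧ PolyboundedIn (V n ∩ K) := by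
    intro n
    have hn : V n ∈ insert ∅ T := hV ▸ Set.mem_range_self n
    rcases hn with hn | hn
    · rw [hn]
      exact ⟨isOpen_empty, ∅, Set.finite_empty, by simp, by simp⟩
    · exact hTS hn
  refine ⟨fun k => ⋃ n ∈ Set.Iic k, V n, fun k l hkl => ?_, fun k => ?_, fun p hp => ?_,
    fun k => ?_⟩
  · exact Set.biUnion_subset_biUnion_left (Set.Iic_subset_Iic.2 hkl)
  · exact isOpen_biUnion fun n _ => (hVmem n).1
  · obtain ⟨O, hO, hpO, hOK⟩ := hloc p hp
    have hmem : p ∈ ⋃₀ T := hTU ▸ ⟨O, ⟨hO, hOK⟩, hpO⟩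
    obtain ⟨W, hW, hpW⟩ := hmem
    obtain ⟨n, rfl⟩ : W ∈ Set.range V := hV ▸ Set.mem_insert_of_mem _ hW
    exact Set.mem_iUnion.2 ⟨n, Set.mem_iUnion₂.2 ⟨n, Set.mem_Iic.2 le_rfl, hpW⟩⟩
  · simp only [Set.iUnion₂_inter]
    exact PolyboundedIn.biUnion (Set.finite_Iic k) fun n _ => (hVmem n).2

theorem hasZeroFilter_of_locally_polyboundedIn [TopologicalSpace.SeparableSpace X]
    (hsub : Subinvariant (fun x y : X => dist x y)) {K : Set X} (hne : K.Nonempty)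
    (hK : IsIdeal K) (hloc : ∀ p ∈ K, ∃ O, IsOpen O ∧ p ∈ O ∧ PolyboundedIn (O ∩ K))
    (hX : ¬ Polybounded X) : HasZeroFilter X := by
  obtain ⟨O, hOmono, hOopen, hOcov, hOpoly⟩ := exists_monotone_polyboundedIn hloc
  have : Nonempty X := hne.to_type
  let d : ℕ → X := TopologicalSpace.denseSeq X
  have hz : ∀ (k : ℕ) (E : Set X), E.Finite → ∃ z ∈ K, ∀ f ∈ polyLevel E k, f z ∉ O k :=
    fun k E hE => exists_avoiding_of_not_polybounded hne hK (hOpoly k) hX (finite_polyLevel hE k)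
      fun f hf => isPoly_of_mem_polyLevel hf
  choose! ζ hζK hζO using hz
  let E : ℕ → Set X := Nat.rec ∅ fun k E => insert (d k) E ∪ (fun f => f (ζ k E)) '' polyLevel E k
  have hE : ∀ k, E (k + 1) = insert (d k) (E k) ∪ (fun f => f (ζ k (E k))) '' polyLevel (E k) k :=
    fun k => rfl
  have hEfin : ∀ k, (E k).Finite := by
    intro k
    induction k with
    | zero => exact Set.finite_empty
    | succ k ih => exact (ih.insert _).union ((finite_polyLevel ih k).image _)
  have hEmono : Monotone E := monotone_nat_of_le_succ fun k =>
    (Set.subset_insert _ _).trans Set.subset_union_left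
  let z : ℕ → X := fun k => ζ k (E k)
  have hzK : ∀ k, z k ∈ K := fun k => hζK k _ (hEfin k)
  have hzO : ∀ k, ∀ f ∈ polyLevel (E k) k, f (z k) ∉ O k := fun k => hζO k _ (hEfin k)
  have hdE : ∀ {m k}, m < k → d m ∈ E k := fun h =>
    hEmono (Nat.succ_le_of_lt h) (Or.inl (Set.mem_insert _ _))
  have hzE : ∀ {l k j : ℕ}, l < k → j ≤ l → ∀ f ∈ polyLevel (E l) j, f (z l) ∈ E k :=
    fun h hj f hf => hEmono (Nat.succ_le_of_lt h)
      (Or.inr ⟨f, monotone_polyLevel _ hj hf, rfl⟩)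
  let U : ℕ → Set X := fun n => {w | w ∈ K ∧ ∃ k j, n + j ≤ k ∧ ∃ f ∈ polyLevel (E k) j,
    dist w (f (z k)) < (1 / 2) ^ n}
  have hpow : ∀ {m n : ℕ}, m ≤ n → ((1 : ℝ) / 2) ^ n ≤ (1 / 2) ^ m := fun h =>
    pow_le_pow_of_le_one (by norm_num) (by norm_num) h
  have hhalf : ∀ n : ℕ, ((1 : ℝ) / 2) ^ (n + 1) + (1 / 2) ^ (n + 1) = (1 / 2) ^ n := fun n => by
    ring
  have hanti : Antitone U := by
    rintro m n hmn w ⟨hw, k, j, hk, f, hf, hd⟩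
    exact ⟨hw, k, j, by omega, f, hf, hd.trans_le (hpow hmn)⟩
  refine hasZeroFilter_of_directed U hanti.directed_ge
    (fun n => ⟨z n, hzK n, n, 0, le_rfl, id, id_mem_polyLevel _ _, by simp⟩) (fun x => ?_)
    (fun i => ⟨i + 1, ?_⟩) fun x i => ?_
  · by_cases hx : x ∈ K
    · obtain ⟨i, hi⟩ := Set.mem_iUnion.1 (hOcov hx)
      obtain ⟨r, hr, hball⟩ := Metric.isOpen_iff.1 (hOopen i) x hi
      obtain ⟨n, hn⟩ := exists_pow_lt_of_lt_one hr (by norm_num : (1 / 2 : ℝ) < 1)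
      refine ⟨max i n, ?_⟩
      rintro ⟨-, k, j, hk, f, hf, hd⟩
      have hik : i ≤ k := (le_max_left i n).trans (by omega)
      refine hzO k f (monotone_polyLevel _ (by omega) hf) (hOmono hik (hball ?_))
      rw [Metric.mem_ball, dist_comm]
      exact (hd.trans_le (hpow (le_max_right i n))).trans hn
    · exact ⟨0, fun h => hx h.1⟩
  · rintro x ⟨hxK, k₁, j₁, hk₁, f₁, hf₁, hd₁⟩ y ⟨hyK, k₂, j₂, hk₂, f₂, hf₂, hd₂⟩
    have hd : dist (x * y) (f₁ (z k₁) * f₂ (z k₂)) < (1 / 2) ^ i := by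
      refine (hsub.dist_mul_mul_le _ _ _ _).trans_lt ?_
      rw [← hhalf i]
      exact add_lt_add hd₁ hd₂
    refine ⟨(hK x hxK y).1, ?_⟩
    rcases lt_trichotomy k₁ k₂ with h | rfl | h
    · exact ⟨k₂, j₂ + 1, by omega, _,
        const_mul_mem_polyLevel (hzE h (by omega) f₁ hf₁) hf₂, hd⟩
    · exact ⟨k₁, max j₁ j₂ + 1, by omega, _,
        mul_mem_polyLevel (monotone_polyLevel _ (le_max_left j₁ j₂) hf₁)
          (monotone_polyLevel _ (le_max_right j₁ j₂) hf₂), hd⟩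
    · exact ⟨k₁, j₁ + 1, by omega, _,
        mul_const_mem_polyLevel (hzE h (by omega) f₂ hf₂) hf₁, hd⟩
  · obtain ⟨_, hm, m, rfl⟩ := Metric.dense_iff.1 (TopologicalSpace.denseRange_denseSeq X) x
      ((1 / 2) ^ (i + 1)) (by positivity)
    rw [Metric.mem_ball, dist_comm] at hm
    refine ⟨max (m + 1) (i + 1), ?_⟩
    rintro y ⟨hyK, k, j, hk, f, hf, hd⟩
    have hd' := hd.trans_le (hpow (le_max_right (m + 1) (i + 1)))
    have hmk : d m ∈ E k := hdE (by omega)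
    refine ⟨⟨(hK y hyK x).2, k, j + 1, by omega, _, const_mul_mem_polyLevel hmk hf, ?_⟩,
      ⟨(hK y hyK x).1, k, j + 1, by omega, _, mul_const_mem_polyLevel hmk hf, ?_⟩⟩
    · refine (hsub.dist_mul_mul_le x y (d m) (f (z k))).trans_lt ?_
      rw [← hhalf i]
      exact add_lt_add hm hd'
    · refine (hsub.dist_mul_mul_le y x (f (z k)) (d m)).trans_lt ?_
      rw [← hhalf i]
      exact add_lt_add hd' hm

end SubinvariantMetric

section ClosedIdeals

variable {X : Type u} [Semigroup X] [TopologicalSpace X]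

theorem exists_minimal_closed_ideal [Nonempty X] (hzero : ¬ HasZeroFilter X) :
    ∃ K : Set X, K.Nonempty ∧ IsClosed K ∧ IsIdeal K ∧
      ∀ I : Set X, I.Nonempty → IsClosed I → IsIdeal I → K ⊆ I := by
  let S : Set (Set X) := {I | I.Nonempty ∧ IsClosed I ∧ IsIdeal I}
  refine ⟨⋂₀ S, ?_, isClosed_sInter fun I hI => hI.2.1, fun x hx a => ?_, fun I h₁ h₂ h₃ =>
    Set.sInter_subset_of_mem ⟨h₁, h₂, h₃⟩⟩
  · by_contra hempty
    have : Nonempty S :=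
      ⟨⟨Set.univ, Set.univ_nonempty, isClosed_univ, fun _ _ _ => ⟨trivial, trivial⟩⟩⟩
    refine hzero (hasZeroFilter_of_directed (fun I : S => (I : Set X)) ?_ (fun I => I.2.1) ?_
      (fun I => ⟨I, fun x hx y _ => (I.2.2.2 x hx y).1⟩)
      fun x I => ⟨I, fun y hy => (I.2.2.2 y hy x).symm⟩)
    · rintro ⟨I, ⟨x, hx⟩, hIc, hI⟩ ⟨J, ⟨y, hy⟩, hJc, hJ⟩
      exact ⟨⟨I ∩ J, ⟨x * y, (hI x hx y).1, (hJ y hy x).2⟩, hIc.inter hJc, hI.inter hJ⟩,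
        Set.inter_subset_left, Set.inter_subset_right⟩
    · intro x
      by_contra! h
      exact hempty ⟨x, fun I hI => h ⟨I, hI⟩⟩
  · exact ⟨fun I hI => (hI.2.2 x (hx I hI) a).1, fun I hI => (hI.2.2 x (hx I hI) a).2⟩

theorem locally_polyboundedIn_of_minimal [ContinuousMul X] {K : Set X} (hKc : IsClosed K)
    (hK : IsIdeal K) (hmin : ∀ I : Set X, I.Nonempty → IsClosed I → IsIdeal I → K ⊆ I)
    {O : Set X} (hO : IsOpen O) (hOK : (O ∩ K).Nonempty) (hpoly : PolyboundedIn (O ∩ K)) :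
    ∀ p ∈ K, ∃ O, IsOpen O ∧ p ∈ O ∧ PolyboundedIn (O ∩ K) := by
  let V : Set X := ⋃₀ {O | IsOpen O ∧ PolyboundedIn (O ∩ K)}
  have hV : IsOpen V := isOpen_sUnion fun O hO => hO.1
  have hpre : ∀ {x : X} {f : X → X}, f x ∈ V → IsPoly f → x ∈ V := by
    rintro x f ⟨O, ⟨hO, hOK⟩, hx⟩ hf
    refine ⟨f ⁻¹' O, ⟨hO.preimage hf.continuous, (hOK.preimage hf).mono fun y hy => ?_⟩, hx⟩
    exact ⟨hy.1, hf.map_mem hK hy.2⟩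
  have hI : IsIdeal (K \ V) := fun x hx a =>
    ⟨⟨(hK x hx.1 a).1, fun h => hx.2 (hpre h (IsPoly.id.mul_const a))⟩,
      ⟨(hK x hx.1 a).2, fun h => hx.2 (hpre h (IsPoly.id.const_mul a))⟩⟩
  intro p hp
  by_contra hpV
  have hpI : p ∈ K \ V := by
    refine ⟨hp, ?_⟩
    rintro ⟨W, ⟨hW, hWK⟩, hpW⟩
    exact hpV ⟨W, hW, hpW, hWK⟩
  obtain ⟨q, hqO, hqK⟩ := hOK
  exact (hmin _ ⟨p, hpI⟩ (hKc.sdiff hV) hI hqK).2 ⟨O, ⟨hO, hpoly⟩, hqO⟩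

end ClosedIdeals

/-- Let `X` be a semigroup with a separable subinvariant metric and
`|X| ≤ cov(M)`, whose image is closed under every injective homomorphism into a
Polish topological semigroup or a Hausdorff 0-discrete topological semigroup.
Then `X` is polybounded. -/
theorem statement16 {X : Type u} [Semigroup X] [MetricSpace X]
    [TopologicalSpace.SeparableSpace X]
    (hsub : Subinvariant (fun x y : X => dist x y))
    (hcard : Cardinal.mk X ≤ Cardinal.lift.{u} covMeager)
    (hPolish : ∀ (Y : Type u) [Semigroup Y] [TopologicalSpace Y],
      ∀ [ContinuousMul Y] [PolishSpace Y],
      ∀ f : X →ₙ* Y, Function.Injective f → IsClosed (Set.range f))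
    (hDiscr : ∀ (Y : Type u) [Semigroup Y] [TopologicalSpace Y],
      ∀ [ContinuousMul Y] [T2Space Y], ∀ z : Y,
      ¬ IsOpen ({z} : Set Y) → (∀ y : Y, y ≠ z → IsOpen ({y} : Set Y)) →
      (∀ y : Y, z * y = z ∧ y * z = z) →
      ∀ f : X →ₙ* Y, Function.Injective f → IsClosed (Set.range f)) :
    Polybounded X := by
  by_contra hX
  have : Nonempty X := by
    by_contra h
    rw [not_nonempty_iff] at h
    exact hX ⟨∅, Set.finite_empty, by simp, fun x => isEmptyElim x⟩
  have hzero : ¬ HasZeroFilter X := not_hasZeroFilter hDiscr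
  have : ContinuousMul X := hsub.continuousMul
  have : CompleteSpace X := hsub.completeSpace hPolish
  obtain ⟨K, hKne, hKc, hK, hmin⟩ := exists_minimal_closed_ideal hzero
  obtain ⟨C, hCalg, hCcov, hCcard⟩ : ∃ C : Set (Set X), (∀ A ∈ C, IsAlgebraicSet A) ∧
      ⋃₀ C = Set.univ ∧ #C < Cardinal.lift.{u} covMeager := by
    rcases lt_or_ge ℵ₀ #X with h | h
    · obtain ⟨C, hC, hcov, hlt⟩ := exists_algebraic_cover_mk_lt h hzero
      exact ⟨C, hC, hcov, hlt.trans_le hcard⟩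
    · refine ⟨Set.range fun x : X => {x}, ?_, ?_, (Cardinal.mk_range_le.trans h).trans_lt
        (Cardinal.aleph0_lt_lift.2 aleph0_lt_covMeager)⟩
      · rintro _ ⟨x, rfl⟩
        exact isAlgebraicSet_singleton x
      · exact Set.eq_univ_of_forall fun x => ⟨{x}, ⟨x, rfl⟩, rfl⟩
  have : Nonempty K := hKne.to_subtype
  have : CompleteSpace K := hKc.completeSpace_coe
  have : SecondCountableTopology X := UniformSpace.secondCountable_of_separable X
  obtain ⟨⟨A, hA⟩, p, hp⟩ := exists_nonempty_interior_of_mk_lt (Z := K) hCcard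
    (A := fun A : C => ((↑) : K → X) ⁻¹' A)
    (fun A => (hCalg A A.2).isClosed.preimage continuous_subtype_val)
    (Set.eq_univ_of_forall fun p => by
      obtain ⟨A, hA, hpA⟩ : (p : X) ∈ ⋃₀ C := hCcov ▸ trivial
      exact Set.mem_iUnion.2 ⟨⟨A, hA⟩, hpA⟩)
  obtain ⟨T, hT, hTo, hpT⟩ := mem_interior.1 hp
  obtain ⟨O, hO, rfl⟩ := isOpen_induced_iff.1 hTo
  have hOA : PolyboundedIn (O ∩ K) :=
    (hCalg A hA).polyboundedIn.mono fun x hx => hT (a := ⟨x, hx.2⟩) hx.1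
  exact hzero (hasZeroFilter_of_locally_polyboundedIn hsub hKne hK
    (locally_polyboundedIn_of_minimal hKc hK hmin hO ⟨p, hpT, p.2⟩ hOA) hX)

end ZeroClosedPaper
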